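/- arXiv:2307.09064 — 2 statements merged into one kernel-verified Lean document; each statement's English description precedes it below -/
import Mathlib

section
/- Let (C, ⟦·⟧^C) be a Markov-algebra interpretation, (M, ⟦·⟧^M) an ωPMA interpretation, and ⊩ ⊆ C × M a soundness relation. Then for every regular infinite-tree expression E ∈ RegExp^∞(F,K), every γ : K → C and γ♯ : K → M with γ(Z) ⊩ γ♯(Z) for all Z ∈ K, and every ν ∈ Cⁿ and ν♯ ∈ Mⁿ with ν_i ⊩ ν♯_i for i = 1,…,n, it holds that C_γ⟦E⟧(ν) ⊩ M_{γ♯}⟦E⟧(ν♯). -/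
abbrev Prob : Type := Set.Icc (0 : ℝ) 1

/-- The order induced by a `combine` operation: `a ⊑ b ↔ ∃ d, a ⊕ d = b`. -/
def srle {M : Type} (add : M → M → M) (a b : M) : Prop := ∃ d, add a d = b

/-- `s` is the supremum of the ω-chain `c` with respect to the relation `le`. -/
def IsChainSup {M : Type} (le : M → M → Prop) (c : ℕ → M) (s : M) : Prop :=
  (∀ i, le (c i) s) ∧ ∀ u, (∀ i, le (c i) u) → le s u

/-- `f` is ω-continuous w.r.t. `le`: monotone and preserving suprema of ω-chains. -/
def IsOmegaCont {M : Type} (le : M → M → Prop) (f : M → M) : Prop :=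
  (∀ a b, le a b → le (f a) (f b)) ∧
  ∀ (c : ℕ → M) (s : M), (∀ i, le (c i) (c (i + 1))) → IsChainSup le c s →
    IsChainSup le (fun i => f (c i)) (f s)

/-- An ω-continuous pre-Markov algebra (ωPMA) over a set `L` of logical conditions:
an ω-continuous semiring `⟨M, ⊕, ⊗, 0, 1⟩` (with induced order `⊑`), together with
ω-continuous confluence operations `◃φ▹`, `⋄p`, `⌣`, where `◃φ▹` and `⋄p` distribute
over `⊕` componentwise. -/
structure OmegaPMA (L : Type) (M : Type) where
  add : M → M → M
  mul : M → M → M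
  zero : M
  one : M
  cond : L → M → M → M
  prob : Prob → M → M → M
  ndet : M → M → M
  add_assoc : ∀ a b c, add (add a b) c = add a (add b c)
  add_comm : ∀ a b, add a b = add b a
  add_zero : ∀ a, add a zero = a
  mul_assoc : ∀ a b c, mul (mul a b) c = mul a (mul b c)
  one_mul : ∀ a, mul one a = a
  mul_one : ∀ a, mul a one = a
  left_distrib : ∀ a b c, mul a (add b c) = add (mul a b) (mul a c)
  right_distrib : ∀ a b c, mul (add a b) c = add (mul a c) (mul b c)
  le_antisymm : ∀ a b, srle add a b → srle add b a → a = b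
  chain_sup : ∀ c : ℕ → M, (∀ i, srle add (c i) (c (i + 1))) →
    ∃ s, IsChainSup (srle add) c s
  add_cont_left : ∀ a, IsOmegaCont (srle add) fun x => add x a
  add_cont_right : ∀ a, IsOmegaCont (srle add) (add a)
  mul_cont_left : ∀ a, IsOmegaCont (srle add) fun x => mul x a
  mul_cont_right : ∀ a, IsOmegaCont (srle add) (mul a)
  cond_cont_left : ∀ φ a, IsOmegaCont (srle add) fun x => cond φ x a
  cond_cont_right : ∀ φ a, IsOmegaCont (srle add) (cond φ a)
  prob_cont_left : ∀ p a, IsOmegaCont (srle add) fun x => prob p x a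
  prob_cont_right : ∀ p a, IsOmegaCont (srle add) (prob p a)
  ndet_cont_left : ∀ a, IsOmegaCont (srle add) fun x => ndet x a
  ndet_cont_right : ∀ a, IsOmegaCont (srle add) (ndet a)
  cond_add : ∀ φ a b c d, cond φ (add a b) (add c d) = add (cond φ a c) (cond φ b d)
  prob_add : ∀ p a b c d, prob p (add a b) (add c d) = add (prob p a c) (prob p b d)

/-- The induced order `⊑` of an ωPMA. -/
def OmegaPMA.le {L M : Type} (P : OmegaPMA L M) : M → M → Prop := srle P.add

/-- Algebraic regular infinite-tree expressions over the alphabet `F^α`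
(constants `c ∈ M`, `seq[c]`, `call[X_i]`, the confluences, concatenation `++_z`,
and μ-binders). -/
inductive AExp (L : Type) (M : Type) (K : Type) (n : ℕ) where
  | const (c : M)
  | var (z : K)
  | seq (c : M) (E : AExp L M K n)
  | call (i : Fin n) (E : AExp L M K n)
  | cond (φ : L) (E₁ E₂ : AExp L M K n)
  | prob (p : Prob) (E₁ E₂ : AExp L M K n)
  | ndet (E₁ E₂ : AExp L M K n)
  | concat (z : K) (E₁ E₂ : AExp L M K n)
  | mu (z : K) (E : AExp L M K n)

/-- Free variables of an algebraic regular infinite-tree expression. -/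
def AExp.fv {L M K : Type} {n : ℕ} : AExp L M K n → Set K
  | .const _ => ∅
  | .var z => {z}
  | .seq _ E => E.fv
  | .call _ E => E.fv
  | .cond _ E₁ E₂ => E₁.fv ∪ E₂.fv
  | .prob _ E₁ E₂ => E₁.fv ∪ E₂.fv
  | .ndet E₁ E₂ => E₁.fv ∪ E₂.fv
  | .concat z E₁ E₂ => (E₁.fv \ {z}) ∪ E₂.fv
  | .mu z E => E.fv \ {z}

/-- The interpretation `M_γ⟦E⟧(ν)` of an algebraic regular infinite-tree expression in
an ωPMA, under valuation `γ` and procedure-summary vector `ν`; μ-binders are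
interpreted as least fixed points (starting from `0`, w.r.t. `⊑`). -/
inductive AInterp {L M K : Type} {n : ℕ} [DecidableEq K] (P : OmegaPMA L M) :
    AExp L M K n → (K → M) → (Fin n → M) → M → Prop where
  | const (γ : K → M) (ν : Fin n → M) (c : M) : AInterp P (.const c) γ ν c
  | var (γ : K → M) (ν : Fin n → M) (z : K) : AInterp P (.var z) γ ν (γ z)
  | seq (c : M) {E : AExp L M K n} {γ : K → M} {ν : Fin n → M} {v : M} :
      AInterp P E γ ν v → AInterp P (.seq c E) γ ν (P.mul c v)
  | call (i : Fin n) {E : AExp L M K n} {γ : K → M} {ν : Fin n → M} {v : M} :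
      AInterp P E γ ν v → AInterp P (.call i E) γ ν (P.mul (ν i) v)
  | cond (φ : L) {E₁ E₂ : AExp L M K n} {γ : K → M} {ν : Fin n → M} {v₁ v₂ : M} :
      AInterp P E₁ γ ν v₁ → AInterp P E₂ γ ν v₂ →
      AInterp P (.cond φ E₁ E₂) γ ν (P.cond φ v₁ v₂)
  | prob (p : Prob) {E₁ E₂ : AExp L M K n} {γ : K → M} {ν : Fin n → M} {v₁ v₂ : M} :
      AInterp P E₁ γ ν v₁ → AInterp P E₂ γ ν v₂ →
      AInterp P (.prob p E₁ E₂) γ ν (P.prob p v₁ v₂)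
  | ndet {E₁ E₂ : AExp L M K n} {γ : K → M} {ν : Fin n → M} {v₁ v₂ : M} :
      AInterp P E₁ γ ν v₁ → AInterp P E₂ γ ν v₂ →
      AInterp P (.ndet E₁ E₂) γ ν (P.ndet v₁ v₂)
  | concat (z : K) {E₁ E₂ : AExp L M K n} {γ : K → M} {ν : Fin n → M} {v₂ v : M} :
      AInterp P E₂ γ ν v₂ → AInterp P E₁ (Function.update γ z v₂) ν v →
      AInterp P (.concat z E₁ E₂) γ ν v
  | mu (z : K) {E : AExp L M K n} {γ : K → M} {ν : Fin n → M} (g : M → M) {v : M} :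
      (∀ θ, AInterp P E (Function.update γ z θ) ν (g θ)) →
      g v = v → (∀ w, g w = w → P.le v w) →
      AInterp P (.mu z E) γ ν v

/-- Linear algebraic regular infinite-tree expressions over the alphabet `F^α_lin`
(linear calls `call_lin[Y_i;c]`, plus `⊕(,)` and `⊖(,)`). -/
inductive LExp (L : Type) (M : Type) (K : Type) (n : ℕ) where
  | const (c : M)
  | var (z : K)
  | seq (c : M) (E : LExp L M K n)
  | callLin (i : Fin n) (c : M)
  | cond (φ : L) (E₁ E₂ : LExp L M K n)
  | prob (p : Prob) (E₁ E₂ : LExp L M K n)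
  | ndet (E₁ E₂ : LExp L M K n)
  | add (E₁ E₂ : LExp L M K n)
  | sub (E₁ E₂ : LExp L M K n)
  | concat (z : K) (E₁ E₂ : LExp L M K n)
  | mu (z : K) (E : LExp L M K n)

/-- All variables occurring in a linear expression. -/
def LExp.vars {L M K : Type} {n : ℕ} : LExp L M K n → Set K
  | .const _ => ∅
  | .var z => {z}
  | .seq _ E => E.vars
  | .callLin _ _ => ∅
  | .cond _ E₁ E₂ => E₁.vars ∪ E₂.vars
  | .prob _ E₁ E₂ => E₁.vars ∪ E₂.vars
  | .ndet E₁ E₂ => E₁.vars ∪ E₂.vars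
  | .add E₁ E₂ => E₁.vars ∪ E₂.vars
  | .sub E₁ E₂ => E₁.vars ∪ E₂.vars
  | .concat z E₁ E₂ => insert z (E₁.vars ∪ E₂.vars)
  | .mu z E => insert z E.vars

/-- The interpretation `M_γ⟦E⟧(ν)` of a linear regular infinite-tree expression in an
ωPMA (the `⊖` symbol denotes any element `d` with `b ⊕ d = a`). -/
inductive LInterp {L M K : Type} {n : ℕ} [DecidableEq K] (P : OmegaPMA L M) :
    LExp L M K n → (K → M) → (Fin n → M) → M → Prop where
  | const (γ : K → M) (ν : Fin n → M) (c : M) : LInterp P (.const c) γ ν c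
  | var (γ : K → M) (ν : Fin n → M) (z : K) : LInterp P (.var z) γ ν (γ z)
  | seq (c : M) {E : LExp L M K n} {γ : K → M} {ν : Fin n → M} {v : M} :
      LInterp P E γ ν v → LInterp P (.seq c E) γ ν (P.mul c v)
  | callLin (γ : K → M) (ν : Fin n → M) (i : Fin n) (c : M) :
      LInterp P (.callLin i c) γ ν (P.mul (ν i) c)
  | cond (φ : L) {E₁ E₂ : LExp L M K n} {γ : K → M} {ν : Fin n → M} {v₁ v₂ : M} :
      LInterp P E₁ γ ν v₁ → LInterp P E₂ γ ν v₂ →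
      LInterp P (.cond φ E₁ E₂) γ ν (P.cond φ v₁ v₂)
  | prob (p : Prob) {E₁ E₂ : LExp L M K n} {γ : K → M} {ν : Fin n → M} {v₁ v₂ : M} :
      LInterp P E₁ γ ν v₁ → LInterp P E₂ γ ν v₂ →
      LInterp P (.prob p E₁ E₂) γ ν (P.prob p v₁ v₂)
  | ndet {E₁ E₂ : LExp L M K n} {γ : K → M} {ν : Fin n → M} {v₁ v₂ : M} :
      LInterp P E₁ γ ν v₁ → LInterp P E₂ γ ν v₂ →
      LInterp P (.ndet E₁ E₂) γ ν (P.ndet v₁ v₂)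
  | add {E₁ E₂ : LExp L M K n} {γ : K → M} {ν : Fin n → M} {v₁ v₂ : M} :
      LInterp P E₁ γ ν v₁ → LInterp P E₂ γ ν v₂ →
      LInterp P (.add E₁ E₂) γ ν (P.add v₁ v₂)
  | sub {E₁ E₂ : LExp L M K n} {γ : K → M} {ν : Fin n → M} {v₁ v₂ d : M} :
      LInterp P E₁ γ ν v₁ → LInterp P E₂ γ ν v₂ → P.add v₂ d = v₁ →
      LInterp P (.sub E₁ E₂) γ ν d
  | concat (z : K) {E₁ E₂ : LExp L M K n} {γ : K → M} {ν : Fin n → M} {v₂ v : M} :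
      LInterp P E₂ γ ν v₂ → LInterp P E₁ (Function.update γ z v₂) ν v →
      LInterp P (.concat z E₁ E₂) γ ν v
  | mu (z : K) {E : LExp L M K n} {γ : K → M} {ν : Fin n → M} (g : M → M) {v : M} :
      (∀ θ, LInterp P E (Function.update γ z θ) ν (g θ)) →
      g v = v → (∀ w, g w = w → P.le v w) →
      LInterp P (.mu z E) γ ν v

/-- The differential `D_{X_j} f_γ|_ν(Y)` of an algebraic regular infinite-tree
expression with respect to procedure `X_j` at `ν` under valuation `γ`. -/
inductive Diff {L M K : Type} {n : ℕ} [DecidableEq K] (P : OmegaPMA L M) (j : Fin n) :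
    AExp L M K n → (K → M) → (Fin n → M) → LExp L M K n → Prop where
  | const {γ : K → M} {ν : Fin n → M} (c : M) :
      Diff P j (.const c) γ ν (.const P.zero)
  | seq (c : M) {g : AExp L M K n} {γ : K → M} {ν : Fin n → M} {g' : LExp L M K n} :
      Diff P j g γ ν g' → Diff P j (.seq c g) γ ν (.seq c g')
  | call_ne (k : Fin n) (hk : k ≠ j) {g : AExp L M K n} {γ : K → M} {ν : Fin n → M}
      {g' : LExp L M K n} :
      Diff P j g γ ν g' → Diff P j (.call k g) γ ν (.seq (ν k) g')
  | call_eq {g : AExp L M K n} {γ : K → M} {ν : Fin n → M} {g' : LExp L M K n} {a : M} :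
      AInterp P g γ ν a → Diff P j g γ ν g' →
      Diff P j (.call j g) γ ν (.add (.callLin j a) (.seq (ν j) g'))
  | cond (φ : L) {g h : AExp L M K n} {γ : K → M} {ν : Fin n → M}
      {g' h' : LExp L M K n} :
      Diff P j g γ ν g' → Diff P j h γ ν h' →
      Diff P j (.cond φ g h) γ ν (.cond φ g' h')
  | prob (p : Prob) {g h : AExp L M K n} {γ : K → M} {ν : Fin n → M}
      {g' h' : LExp L M K n} :
      Diff P j g γ ν g' → Diff P j h γ ν h' →
      Diff P j (.prob p g h) γ ν (.prob p g' h')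
  | ndet {g h : AExp L M K n} {γ : K → M} {ν : Fin n → M} {g' h' : LExp L M K n}
      {a b c : M} :
      AInterp P g γ ν a → AInterp P h γ ν b → AInterp P (.ndet g h) γ ν c →
      Diff P j g γ ν g' → Diff P j h γ ν h' →
      Diff P j (.ndet g h) γ ν
        (.sub (.ndet (.add (.const a) g') (.add (.const b) h')) (.const c))
  | var {γ : K → M} {ν : Fin n → M} (z : K) : Diff P j (.var z) γ ν (.var z)
  | concat (z : K) {g h : AExp L M K n} {γ : K → M} {ν : Fin n → M}
      {g' h' : LExp L M K n} {b : M} :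
      AInterp P h γ ν b → Diff P j g (Function.update γ z b) ν g' →
      Diff P j h γ ν h' →
      Diff P j (.concat z g h) γ ν (.concat z g' h')
  | mu (z : K) {g : AExp L M K n} {γ : K → M} {ν : Fin n → M} {g' : LExp L M K n}
      {a : M} :
      AInterp P (.mu z g) γ ν a → Diff P j g (Function.update γ z a) ν g' →
      Diff P j (.mu z g) γ ν (.mu z g')

/-- `⊕`-fold of the components of a vector of linear expressions. -/
def foldAddL {L M K : Type} {n m : ℕ} (P : OmegaPMA L M) (d : Fin m → LExp L M K n) :
    LExp L M K n :=
  match List.ofFn d with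
  | [] => .const P.zero
  | x :: xs => xs.foldl .add x

/-- The multivariate differential `D f_γ|_ν(Y) = D_{X_1} f_γ|_ν(Y) ⊕ ⋯ ⊕ D_{X_n} f_γ|_ν(Y)`. -/
def DiffAll {L M K : Type} {n : ℕ} [DecidableEq K] (P : OmegaPMA L M)
    (f : AExp L M K n) (γ : K → M) (ν : Fin n → M) (E' : LExp L M K n) : Prop :=
  ∃ d : Fin n → LExp L M K n, (∀ j, Diff P j f γ ν (d j)) ∧ E' = foldAddL P d

/-- Regular infinite-tree expressions over the program alphabet `F` (data actions,
conditions, probabilistic and nondeterministic choice, and procedure calls). -/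
inductive PExp (A : Type) (L : Type) (K : Type) (n : ℕ) where
  | eps
  | var (z : K)
  | seq (act : A) (E : PExp A L K n)
  | call (i : Fin n) (E : PExp A L K n)
  | cond (φ : L) (E₁ E₂ : PExp A L K n)
  | prob (p : Prob) (E₁ E₂ : PExp A L K n)
  | ndet (E₁ E₂ : PExp A L K n)
  | concat (z : K) (E₁ E₂ : PExp A L K n)
  | mu (z : K) (E : PExp A L K n)

/-- Free variables of a program regular infinite-tree expression. -/
def PExp.fv {A L K : Type} {n : ℕ} : PExp A L K n → Set K
  | .eps => ∅
  | .var z => {z}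
  | .seq _ E => E.fv
  | .call _ E => E.fv
  | .cond _ E₁ E₂ => E₁.fv ∪ E₂.fv
  | .prob _ E₁ E₂ => E₁.fv ∪ E₂.fv
  | .ndet E₁ E₂ => E₁.fv ∪ E₂.fv
  | .concat z E₁ E₂ => (E₁.fv \ {z}) ∪ E₂.fv
  | .mu z E => E.fv \ {z}

/-- The interpretation `𝓢𝓜_γ⟦E⟧(ν)` of a program regular infinite-tree expression in
an ωPMA interpretation `(P, ia)`, under valuation `γ` and procedure-summary vector `ν`. -/
inductive PInterp {A L M K : Type} {n : ℕ} [DecidableEq K] (P : OmegaPMA L M)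
    (ia : A → M) : PExp A L K n → (K → M) → (Fin n → M) → M → Prop where
  | eps (γ : K → M) (ν : Fin n → M) : PInterp P ia .eps γ ν P.one
  | var (γ : K → M) (ν : Fin n → M) (z : K) : PInterp P ia (.var z) γ ν (γ z)
  | seq (act : A) {E : PExp A L K n} {γ : K → M} {ν : Fin n → M} {v : M} :
      PInterp P ia E γ ν v → PInterp P ia (.seq act E) γ ν (P.mul (ia act) v)
  | call (i : Fin n) {E : PExp A L K n} {γ : K → M} {ν : Fin n → M} {v : M} :
      PInterp P ia E γ ν v → PInterp P ia (.call i E) γ ν (P.mul (ν i) v)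
  | cond (φ : L) {E₁ E₂ : PExp A L K n} {γ : K → M} {ν : Fin n → M} {v₁ v₂ : M} :
      PInterp P ia E₁ γ ν v₁ → PInterp P ia E₂ γ ν v₂ →
      PInterp P ia (.cond φ E₁ E₂) γ ν (P.cond φ v₁ v₂)
  | prob (p : Prob) {E₁ E₂ : PExp A L K n} {γ : K → M} {ν : Fin n → M} {v₁ v₂ : M} :
      PInterp P ia E₁ γ ν v₁ → PInterp P ia E₂ γ ν v₂ →
      PInterp P ia (.prob p E₁ E₂) γ ν (P.prob p v₁ v₂)
  | ndet {E₁ E₂ : PExp A L K n} {γ : K → M} {ν : Fin n → M} {v₁ v₂ : M} :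
      PInterp P ia E₁ γ ν v₁ → PInterp P ia E₂ γ ν v₂ →
      PInterp P ia (.ndet E₁ E₂) γ ν (P.ndet v₁ v₂)
  | concat (z : K) {E₁ E₂ : PExp A L K n} {γ : K → M} {ν : Fin n → M} {v₂ v : M} :
      PInterp P ia E₂ γ ν v₂ → PInterp P ia E₁ (Function.update γ z v₂) ν v →
      PInterp P ia (.concat z E₁ E₂) γ ν v
  | mu (z : K) {E : PExp A L K n} {γ : K → M} {ν : Fin n → M} (g : M → M) {v : M} :
      (∀ θ, PInterp P ia E (Function.update γ z θ) ν (g θ)) →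
      g v = v → (∀ w, g w = w → P.le v w) →
      PInterp P ia (.mu z E) γ ν v

/-- A Markov algebra over logical conditions `L`: a dcpo with least element, a monoid
`⊗`, confluence operations `◃φ▹`, `⋄p`, `⌣` (all Scott-continuous), with `⌣` an upper
semilattice operation dominating the other two confluences. -/
structure MarkovAlg (L : Type) (C : Type) [PartialOrder C] where
  bot : C
  one : C
  mul : C → C → C
  cond : L → C → C → C
  prob : Prob → C → C → C
  ndet : C → C → C
  bot_le : ∀ a, bot ≤ a
  dcpo : ∀ d : Set C, d.Nonempty → DirectedOn (· ≤ ·) d → ∃ s, IsLUB d s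
  mul_assoc : ∀ a b c, mul (mul a b) c = mul a (mul b c)
  one_mul : ∀ a, mul one a = a
  mul_one : ∀ a, mul a one = a
  ndet_idem : ∀ a, ndet a a = a
  ndet_comm : ∀ a b, ndet a b = ndet b a
  ndet_assoc : ∀ a b c, ndet (ndet a b) c = ndet a (ndet b c)
  cond_le_ndet : ∀ φ a b, ndet (cond φ a b) (ndet a b) = ndet a b
  prob_le_ndet : ∀ p a b, ndet (prob p a b) (ndet a b) = ndet a b
  mul_scott_left : ∀ a, ScottContinuous fun x => mul x a
  mul_scott_right : ∀ a, ScottContinuous (mul a)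
  cond_scott_left : ∀ φ a, ScottContinuous fun x => cond φ x a
  cond_scott_right : ∀ φ a, ScottContinuous (cond φ a)
  prob_scott_left : ∀ p a, ScottContinuous fun x => prob p x a
  prob_scott_right : ∀ p a, ScottContinuous (prob p a)
  ndet_scott_left : ∀ a, ScottContinuous fun x => ndet x a
  ndet_scott_right : ∀ a, ScottContinuous (ndet a)

/-- The interpretation `C_γ⟦E⟧(ν)` of a program regular infinite-tree expression in a
Markov-algebra interpretation `(Q, ia)` (the concrete semantics), under valuation `γ`
and procedure-summary vector `ν`. -/
inductive CInterp {A L C K : Type} [PartialOrder C] {n : ℕ} [DecidableEq K]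
    (Q : MarkovAlg L C) (ia : A → C) :
    PExp A L K n → (K → C) → (Fin n → C) → C → Prop where
  | eps (γ : K → C) (ν : Fin n → C) : CInterp Q ia .eps γ ν Q.one
  | var (γ : K → C) (ν : Fin n → C) (z : K) : CInterp Q ia (.var z) γ ν (γ z)
  | seq (act : A) {E : PExp A L K n} {γ : K → C} {ν : Fin n → C} {v : C} :
      CInterp Q ia E γ ν v → CInterp Q ia (.seq act E) γ ν (Q.mul (ia act) v)
  | call (i : Fin n) {E : PExp A L K n} {γ : K → C} {ν : Fin n → C} {v : C} :
      CInterp Q ia E γ ν v → CInterp Q ia (.call i E) γ ν (Q.mul (ν i) v)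
  | cond (φ : L) {E₁ E₂ : PExp A L K n} {γ : K → C} {ν : Fin n → C} {v₁ v₂ : C} :
      CInterp Q ia E₁ γ ν v₁ → CInterp Q ia E₂ γ ν v₂ →
      CInterp Q ia (.cond φ E₁ E₂) γ ν (Q.cond φ v₁ v₂)
  | prob (p : Prob) {E₁ E₂ : PExp A L K n} {γ : K → C} {ν : Fin n → C} {v₁ v₂ : C} :
      CInterp Q ia E₁ γ ν v₁ → CInterp Q ia E₂ γ ν v₂ →
      CInterp Q ia (.prob p E₁ E₂) γ ν (Q.prob p v₁ v₂)
  | ndet {E₁ E₂ : PExp A L K n} {γ : K → C} {ν : Fin n → C} {v₁ v₂ : C} :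
      CInterp Q ia E₁ γ ν v₁ → CInterp Q ia E₂ γ ν v₂ →
      CInterp Q ia (.ndet E₁ E₂) γ ν (Q.ndet v₁ v₂)
  | concat (z : K) {E₁ E₂ : PExp A L K n} {γ : K → C} {ν : Fin n → C} {v₂ v : C} :
      CInterp Q ia E₂ γ ν v₂ → CInterp Q ia E₁ (Function.update γ z v₂) ν v →
      CInterp Q ia (.concat z E₁ E₂) γ ν v
  | mu (z : K) {E : PExp A L K n} {γ : K → C} {ν : Fin n → C} (g : C → C) {v : C} :
      (∀ θ, CInterp Q ia E (Function.update γ z θ) ν (g θ)) →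
      g v = v → (∀ w, g w = w → v ≤ w) →
      CInterp Q ia (.mu z E) γ ν v

/-- `R ⊆ C × M` is a soundness relation between a Markov-algebra interpretation
`(Q, iaC)` and an ωPMA interpretation `(P, iaM)`: it relates the interpretations of
data actions, the constants, is preserved by all algebraic operations, and is
preserved by (componentwise) least fixed points of related Scott-continuous and
ω-continuous vector functions. -/
def IsSoundRel {A L C M : Type} [PartialOrder C]
    (Q : MarkovAlg L C) (P : OmegaPMA L M)
    (iaC : A → C) (iaM : A → M) (R : C → M → Prop) : Prop :=
  (∀ act : A, R (iaC act) (iaM act)) ∧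
  R Q.bot P.zero ∧
  R Q.one P.one ∧
  (∀ x₁ y₁ x₂ y₂, R x₁ y₁ → R x₂ y₂ →
    R (Q.mul x₁ x₂) (P.mul y₁ y₂) ∧
    (∀ φ : L, R (Q.cond φ x₁ x₂) (P.cond φ y₁ y₂)) ∧
    (∀ p : Prob, R (Q.prob p x₁ x₂) (P.prob p y₁ y₂)) ∧
    R (Q.ndet x₁ x₂) (P.ndet y₁ y₂)) ∧
  (∀ (k : ℕ) (fc : (Fin k → C) → (Fin k → C)) (gm : (Fin k → M) → (Fin k → M)),
    ScottContinuous fc →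
    (∀ y y' : Fin k → M, (∀ i, P.le (y i) (y' i)) → ∀ i, P.le (gm y i) (gm y' i)) →
    (∀ (c : ℕ → Fin k → M) (s : Fin k → M),
      (∀ (j : ℕ) (i : Fin k), P.le (c j i) (c (j + 1) i)) →
      (∀ i, IsChainSup P.le (fun j => c j i) (s i)) →
      ∀ i, IsChainSup P.le (fun j => gm (c j) i) (gm s i)) →
    (∀ (x : Fin k → C) (y : Fin k → M),
      (∀ i, R (x i) (y i)) → ∀ i, R (fc x i) (gm y i)) →
    ∀ (xf : Fin k → C) (yf : Fin k → M),
      (fc xf = xf ∧ ∀ x' : Fin k → C, fc x' = x' → xf ≤ x') →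
      (gm yf = yf ∧ ∀ y' : Fin k → M, gm y' = y' → ∀ i, P.le (yf i) (y' i)) →
      ∀ i, R (xf i) (yf i))

section Continuity

open Set Function

variable {α K : Type} [PartialOrder α]

/-- `f` preserves least upper bounds of monotone families indexed by `J`. -/
def PreservesSup (J : Type) [Preorder J] (f : α → α) : Prop :=
  ∀ (c : J → α) (s : α), Monotone c → IsLUB (range c) s → IsLUB (range fun j => f (c j)) (f s)

/-- `J` is a directed index for which all monotone families in `α` have least upper bounds,
and these are preserved by every operation in `S` in each argument. -/
structure AdmissibleIndex (S : Set (α → α → α)) (J : Type) [Preorder J] : Prop where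
  directed : IsDirectedOrder J
  nonempty : Nonempty J
  exists_isLUB : ∀ c : J → α, Monotone c → ∃ s, IsLUB (range c) s
  left : ∀ f ∈ S, ∀ a, PreservesSup J fun x => f x a
  right : ∀ f ∈ S, ∀ a, PreservesSup J (f a)

/-- `α` has a least element, suprema of ω-chains, and each operation in `S` is monotone and
ω-continuous in each argument. -/
structure OmegaContOps (S : Set (α → α → α)) : Prop where
  exists_bot : ∃ b : α, ∀ a, b ≤ a
  mono_left : ∀ f ∈ S, ∀ a, Monotone fun x => f x a
  mono_right : ∀ f ∈ S, ∀ a, Monotone (f a)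
  nat : AdmissibleIndex S ℕ

/-- The relation `ρ`, read as a partial function of valuations, is monotone and preserves
pointwise least upper bounds of monotone families over admissible indices. -/
structure MonoCont (S : Set (α → α → α)) (ρ : (K → α) → α → Prop) : Prop where
  mono : ∀ {γ γ' : K → α} {v v' : α}, γ ≤ γ' → ρ γ v → ρ γ' v' → v ≤ v'
  cont : ∀ {J : Type} [Preorder J], AdmissibleIndex S J →
    ∀ {γ : J → K → α} {γs : K → α} {v : J → α} {vs : α}, Monotone γ →
      (∀ z, IsLUB (range fun j => γ j z) (γs z)) → (∀ j, ρ (γ j) (v j)) → ρ γs vs →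
      IsLUB (range v) vs

theorem isLUB_range_map₂ {J : Type} [Preorder J] [IsDirectedOrder J] {f : α → α → α}
    (ml : ∀ a, Monotone fun x => f x a) (mr : ∀ a, Monotone (f a))
    (hl : ∀ a, PreservesSup J fun x => f x a) (hr : ∀ a, PreservesSup J (f a))
    {a b : J → α} {s t : α} (ha : Monotone a) (hb : Monotone b)
    (hs : IsLUB (range a) s) (ht : IsLUB (range b) t) :
    IsLUB (range fun j => f (a j) (b j)) (f s t) := by
  refine ⟨?_, fun u hu => ?_⟩
  · rintro _ ⟨j, rfl⟩
    exact (ml _ (hs.1 ⟨j, rfl⟩)).trans (mr _ (ht.1 ⟨j, rfl⟩))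
  · refine (hl t a s ha hs).2 ?_
    rintro _ ⟨i, rfl⟩
    refine (hr (a i) b t hb ht).2 ?_
    rintro _ ⟨j, rfl⟩
    obtain ⟨k, hik, hjk⟩ := exists_ge_ge i j
    exact ((ml _ (ha hik)).trans (mr _ (hb hjk))).trans (hu ⟨k, rfl⟩)

/-- The least fixed point of an ω-continuous function lies below every prefixed point. -/
theorem lfp_le_of_map_le {g : α → α} (hbot : ∃ b : α, ∀ a, b ≤ a)
    (hsup : ∀ c : ℕ → α, Monotone c → ∃ s, IsLUB (range c) s)
    (hmono : Monotone g) (hg : PreservesSup ℕ g) {v w : α}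
    (hv : ∀ u, g u = u → v ≤ u) (hw : g w ≤ w) : v ≤ w := by
  obtain ⟨b, hb⟩ := hbot
  have hc : Monotone fun i => g^[i] b := hmono.monotone_iterate_of_le_map (hb _)
  obtain ⟨s, hs⟩ := hsup _ hc
  have hgs := hg _ s hc hs
  have hfix : g s = s := by
    refine le_antisymm (hgs.2 ?_) (hs.2 ?_)
    · rintro _ ⟨i, rfl⟩
      exact hs.1 ⟨i + 1, iterate_succ_apply' g i b⟩
    · rintro _ ⟨i, rfl⟩
      refine (hc (Nat.le_succ i)).trans (hgs.1 ⟨i, ?_⟩)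
      exact (iterate_succ_apply' g i b).symm
  refine (hv s hfix).trans (hs.2 ?_)
  rintro _ ⟨i, rfl⟩
  induction i with
  | zero => exact hb w
  | succ i ih =>
    change g^[i + 1] b ≤ w
    rw [iterate_succ_apply']
    exact (hmono ih).trans hw

theorem isLUB_range_const {J : Type} [Nonempty J] (a : α) : IsLUB (range fun _ : J => a) a := by
  rw [range_const]
  exact isLUB_singleton

theorem isLUB_range_update [DecidableEq K] {J : Type} {γ : J → K → α} {γs : K → α} {v : J → α}
    {vs : α} (z : K) (hγ : ∀ z, IsLUB (range fun j => γ j z) (γs z)) (hv : IsLUB (range v) vs)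
    (y : K) : IsLUB (range fun j => update (γ j) z (v j) y) (update γs z vs y) := by
  rcases eq_or_ne y z with rfl | h
  · simpa using hv
  · simpa [h] using hγ y

namespace MonoCont

variable {S : Set (α → α → α)} {ρ ρ₁ ρ₂ : (K → α) → α → Prop}

theorem const (a : α) (h : ∀ γ v, ρ γ v → v = a) : MonoCont S ρ where
  mono _ hv hv' := (h _ _ hv).trans (h _ _ hv').symm |>.le
  cont hJ _ _ _ _ _ _ hv hvs := by
    have := hJ.nonempty
    rw [funext fun j => h _ _ (hv j), h _ _ hvs]
    exact isLUB_range_const a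

theorem var (z : K) (h : ∀ γ v, ρ γ v → v = γ z) : MonoCont S ρ where
  mono hγ hv hv' := by
    rw [h _ _ hv, h _ _ hv']
    exact hγ z
  cont _ _ _ _ _ _ hγ hv hvs := by
    rw [funext fun j => h _ _ (hv j), h _ _ hvs]
    exact hγ z

theorem map₂ (hS : OmegaContOps S) {f : α → α → α} (hf : f ∈ S) (h₁ : MonoCont S ρ₁)
    (h₂ : MonoCont S ρ₂)
    (h : ∀ γ v, ρ γ v → ∃ u₁ u₂, ρ₁ γ u₁ ∧ ρ₂ γ u₂ ∧ v = f u₁ u₂) : MonoCont S ρ where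
  mono hγ hv hv' := by
    obtain ⟨u₁, u₂, hu₁, hu₂, rfl⟩ := h _ _ hv
    obtain ⟨w₁, w₂, hw₁, hw₂, rfl⟩ := h _ _ hv'
    exact (hS.mono_left f hf _ (h₁.mono hγ hu₁ hw₁)).trans
      (hS.mono_right f hf _ (h₂.mono hγ hu₂ hw₂))
  cont hJ γ γs v vs hγ hlub hv hvs := by
    have := hJ.directed
    choose u₁ u₂ hu₁ hu₂ hu using fun j => h _ _ (hv j)
    obtain ⟨w₁, w₂, hw₁, hw₂, rfl⟩ := h _ _ hvs
    rw [funext hu]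
    exact isLUB_range_map₂ (hS.mono_left f hf) (hS.mono_right f hf) (hJ.left f hf)
      (hJ.right f hf) (fun i j hij => h₁.mono (hγ hij) (hu₁ i) (hu₁ j))
      (fun i j hij => h₂.mono (hγ hij) (hu₂ i) (hu₂ j))
      (h₁.cont hJ hγ hlub hu₁ hw₁) (h₂.cont hJ hγ hlub hu₂ hw₂)

variable [DecidableEq K]

theorem concat (z : K) (h₁ : MonoCont S ρ₁) (h₂ : MonoCont S ρ₂)
    (h : ∀ γ v, ρ γ v → ∃ u, ρ₂ γ u ∧ ρ₁ (update γ z u) v) : MonoCont S ρ where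
  mono hγ hv hv' := by
    obtain ⟨u, hu, hv⟩ := h _ _ hv
    obtain ⟨u', hu', hv'⟩ := h _ _ hv'
    exact h₁.mono (update_le_update_iff.2 ⟨h₂.mono hγ hu hu', fun y _ => hγ y⟩) hv hv'
  cont hJ γ γs v vs hγ hlub hv hvs := by
    choose u hu hv using fun j => h _ _ (hv j)
    obtain ⟨us, hus, hvs⟩ := h _ _ hvs
    refine h₁.cont hJ (fun i j hij => ?_)
      (isLUB_range_update z hlub (h₂.cont hJ hγ hlub hu hus)) hv hvs
    exact update_le_update_iff.2 ⟨h₂.mono (hγ hij) (hu i) (hu j), fun y _ => hγ hij y⟩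

/-- The function obtained by varying one variable of a valuation is monotone. -/
theorem monotone_update (h : MonoCont S ρ) {z : K} {γ : K → α} {g : α → α}
    (hg : ∀ θ, ρ (update γ z θ) (g θ)) : Monotone g := fun _ _ hab =>
  h.mono (update_le_update_iff.2 ⟨hab, fun _ _ => le_rfl⟩) (hg _) (hg _)

/-- The function obtained by varying one variable of a valuation preserves suprema. -/
theorem preservesSup_update (h : MonoCont S ρ) {J : Type} [Preorder J]
    (hJ : AdmissibleIndex S J) {z : K} {γ : K → α} {g : α → α}
    (hg : ∀ θ, ρ (update γ z θ) (g θ)) : PreservesSup J g := fun c s hc hs => by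
  have := hJ.nonempty
  refine h.cont hJ (fun i j hij => ?_)
    (isLUB_range_update z (fun y => isLUB_range_const (γ y)) hs) (fun j => hg (c j)) (hg s)
  exact update_le_update_iff.2 ⟨hc hij, fun _ _ => le_rfl⟩

theorem mu (hS : OmegaContOps S) (z : K) (h₁ : MonoCont S ρ₁)
    (h : ∀ γ v, ρ γ v → ∃ g : α → α, (∀ θ, ρ₁ (update γ z θ) (g θ)) ∧ g v = v ∧
      ∀ w, g w = w → v ≤ w) : MonoCont S ρ := by
  have mono : ∀ {γ γ' : K → α} {v v' : α}, γ ≤ γ' → ρ γ v → ρ γ' v' → v ≤ v' := by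
    intro γ γ' v v' hγ hv hv'
    obtain ⟨g, hg, -, hmin⟩ := h _ _ hv
    obtain ⟨g', hg', hfix', -⟩ := h _ _ hv'
    refine lfp_le_of_map_le hS.exists_bot hS.nat.exists_isLUB (h₁.monotone_update hg)
      (h₁.preservesSup_update hS.nat hg) hmin ?_
    exact (h₁.mono (update_le_update_iff.2 ⟨le_rfl, fun y _ => hγ y⟩) (hg v') (hg' v')).trans
      hfix'.le
  refine ⟨mono, fun {J} _ hJ {γ γs v vs} hγ hlub hv hvs => ?_⟩
  have hvmono : Monotone v := fun i j hij => mono (hγ hij) (hv i) (hv j)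
  obtain ⟨u, hu⟩ := hJ.exists_isLUB v hvmono
  obtain ⟨gs, hgs, -, hmin⟩ := h _ _ hvs
  choose g hg hfix _ using fun j => h _ _ (hv j)
  have hgu : IsLUB (range v) (gs u) := by
    refine h₁.cont hJ (fun i j hij => ?_) (isLUB_range_update z hlub hu)
      (fun j => by simpa only [hfix] using hg j (v j)) (hgs u)
    exact update_le_update_iff.2 ⟨hvmono hij, fun y _ => hγ hij y⟩
  refine ⟨?_, fun w hw => (hmin u (hgu.unique hu)).trans (hu.2 hw)⟩
  rintro _ ⟨j, rfl⟩
  exact mono (fun y => (hlub y).1 ⟨j, rfl⟩) (hv j) hvs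

end MonoCont

end Continuity

section Markov

open Set

variable {L C : Type} [PartialOrder C]

/-- The binary operations that are Scott-continuous in each argument. -/
def scottOps (C : Type) [PartialOrder C] : Set (C → C → C) :=
  {f | (∀ a, ScottContinuous fun x => f x a) ∧ ∀ a, ScottContinuous (f a)}

theorem ScottContinuous.preservesSup {f : C → C} (hf : ScottContinuous f) {J : Type} [Preorder J]
    [IsDirectedOrder J] [Nonempty J] : PreservesSup J f := fun c s hc hs => by
  have := hf (range_nonempty c) (directedOn_range.2 hc.directed_le) hs
  rwa [← range_comp] at this

theorem MarkovAlg.admissibleIndex (Q : MarkovAlg L C) (J : Type) [Preorder J]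
    [hd : IsDirectedOrder J] [hn : Nonempty J] : AdmissibleIndex (scottOps C) J where
  directed := hd
  nonempty := hn
  exists_isLUB c hc := Q.dcpo _ (range_nonempty c) (directedOn_range.2 hc.directed_le)
  left _ hf a := (hf.1 a).preservesSup
  right _ hf a := (hf.2 a).preservesSup

theorem MarkovAlg.omegaContOps (Q : MarkovAlg L C) : OmegaContOps (scottOps C) where
  exists_bot := ⟨Q.bot, Q.bot_le⟩
  mono_left _ hf a := (hf.1 a).monotone
  mono_right _ hf a := (hf.2 a).monotone
  nat := Q.admissibleIndex ℕ

theorem CInterp.monoCont {A K : Type} [DecidableEq K] {n : ℕ} (Q : MarkovAlg L C) (ia : A → C)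
    (ν : Fin n → C) (E : PExp A L K n) :
    MonoCont (scottOps C) fun γ v => CInterp Q ia E γ ν v := by
  have hS := Q.omegaContOps
  have hmul : Q.mul ∈ scottOps C := ⟨Q.mul_scott_left, Q.mul_scott_right⟩
  induction E with
  | eps => exact .const Q.one fun γ v h => by cases h; rfl
  | var z => exact .var z fun γ v h => by cases h; rfl
  | seq act E ih =>
    exact .map₂ hS hmul (.const (ρ := fun _ v => v = ia act) _ fun _ _ => id) ih
      fun γ v h => by cases h with | seq _ h => exact ⟨_, _, rfl, h, rfl⟩
  | call i E ih =>
    exact .map₂ hS hmul (.const (ρ := fun _ v => v = ν i) _ fun _ _ => id) ih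
      fun γ v h => by cases h with | call _ h => exact ⟨_, _, rfl, h, rfl⟩
  | cond φ E₁ E₂ ih₁ ih₂ =>
    exact .map₂ hS ⟨Q.cond_scott_left φ, Q.cond_scott_right φ⟩ ih₁ ih₂
      fun γ v h => by cases h with | cond _ h₁ h₂ => exact ⟨_, _, h₁, h₂, rfl⟩
  | prob p E₁ E₂ ih₁ ih₂ =>
    exact .map₂ hS ⟨Q.prob_scott_left p, Q.prob_scott_right p⟩ ih₁ ih₂
      fun γ v h => by cases h with | prob _ h₁ h₂ => exact ⟨_, _, h₁, h₂, rfl⟩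
  | ndet E₁ E₂ ih₁ ih₂ =>
    exact .map₂ hS ⟨Q.ndet_scott_left, Q.ndet_scott_right⟩ ih₁ ih₂
      fun γ v h => by cases h with | ndet h₁ h₂ => exact ⟨_, _, h₁, h₂, rfl⟩
  | concat z E₁ E₂ ih₁ ih₂ =>
    exact .concat z ih₁ ih₂
      fun γ v h => by cases h with | concat _ h₂ h₁ => exact ⟨_, h₂, h₁⟩
  | mu z E ih =>
    exact .mu hS z ih
      fun γ v h => by cases h with | mu _ g hg hfix hmin => exact ⟨g, hg, hfix, hmin⟩

end Markov

section OmegaPMA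

open Set

variable {L M : Type}

/-- The partial order induced by `⊕`. -/
abbrev OmegaPMA.partialOrder (P : OmegaPMA L M) : PartialOrder M where
  le := P.le
  le_refl a := ⟨P.zero, P.add_zero a⟩
  le_trans := by
    rintro a _ _ ⟨d, rfl⟩ ⟨e, rfl⟩
    exact ⟨P.add d e, (P.add_assoc a d e).symm⟩
  le_antisymm := P.le_antisymm

theorem OmegaPMA.isChainSup_iff_isLUB (P : OmegaPMA L M) (c : ℕ → M) (s : M) :
    letI := P.partialOrder
    IsChainSup P.le c s ↔ IsLUB (range c) s := by
  let := P.partialOrder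
  simp only [IsLUB, IsLeast, mem_upperBounds, mem_lowerBounds, forall_mem_range]
  rfl

/-- The binary operations that are ω-continuous in each argument. -/
def OmegaPMA.contOps (P : OmegaPMA L M) : Set (M → M → M) :=
  {f | (∀ a, IsOmegaCont P.le fun x => f x a) ∧ ∀ a, IsOmegaCont P.le (f a)}

theorem OmegaPMA.preservesSup (P : OmegaPMA L M) {f : M → M} (hf : IsOmegaCont P.le f) :
    letI := P.partialOrder
    PreservesSup ℕ f := by
  let := P.partialOrder
  intro c s hc hs
  rw [← P.isChainSup_iff_isLUB] at hs ⊢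
  exact hf.2 c s (fun i => hc i.le_succ) hs

theorem OmegaPMA.omegaContOps (P : OmegaPMA L M) :
    letI := P.partialOrder
    OmegaContOps P.contOps := by
  let := P.partialOrder
  refine ⟨⟨P.zero, fun a => ⟨a, by rw [P.add_comm, P.add_zero]⟩⟩, fun f hf a => (hf.1 a).1,
    fun f hf a => (hf.2 a).1, inferInstance, inferInstance, fun c hc => ?_,
    fun f hf a => P.preservesSup (hf.1 a), fun f hf a => P.preservesSup (hf.2 a)⟩
  obtain ⟨s, hs⟩ := P.chain_sup c fun i => hc i.le_succ
  exact ⟨s, (P.isChainSup_iff_isLUB c s).1 hs⟩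

theorem PInterp.monoCont {A K : Type} [DecidableEq K] {n : ℕ} (P : OmegaPMA L M) (ia : A → M)
    (ν : Fin n → M) (E : PExp A L K n) :
    letI := P.partialOrder
    MonoCont P.contOps fun γ v => PInterp P ia E γ ν v := by
  let := P.partialOrder
  have hS := P.omegaContOps
  have hmul : P.mul ∈ P.contOps := ⟨P.mul_cont_left, P.mul_cont_right⟩
  induction E with
  | eps => exact .const P.one fun γ v h => by cases h; rfl
  | var z => exact .var z fun γ v h => by cases h; rfl
  | seq act E ih =>
    exact .map₂ hS hmul (.const (ρ := fun _ v => v = ia act) _ fun _ _ => id) ih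
      fun γ v h => by cases h with | seq _ h => exact ⟨_, _, rfl, h, rfl⟩
  | call i E ih =>
    exact .map₂ hS hmul (.const (ρ := fun _ v => v = ν i) _ fun _ _ => id) ih
      fun γ v h => by cases h with | call _ h => exact ⟨_, _, rfl, h, rfl⟩
  | cond φ E₁ E₂ ih₁ ih₂ =>
    exact .map₂ hS ⟨P.cond_cont_left φ, P.cond_cont_right φ⟩ ih₁ ih₂
      fun γ v h => by cases h with | cond _ h₁ h₂ => exact ⟨_, _, h₁, h₂, rfl⟩
  | prob p E₁ E₂ ih₁ ih₂ =>
    exact .map₂ hS ⟨P.prob_cont_left p, P.prob_cont_right p⟩ ih₁ ih₂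
      fun γ v h => by cases h with | prob _ h₁ h₂ => exact ⟨_, _, h₁, h₂, rfl⟩
  | ndet E₁ E₂ ih₁ ih₂ =>
    exact .map₂ hS ⟨P.ndet_cont_left, P.ndet_cont_right⟩ ih₁ ih₂
      fun γ v h => by cases h with | ndet h₁ h₂ => exact ⟨_, _, h₁, h₂, rfl⟩
  | concat z E₁ E₂ ih₁ ih₂ =>
    exact .concat z ih₁ ih₂
      fun γ v h => by cases h with | concat _ h₂ h₁ => exact ⟨_, h₂, h₁⟩
  | mu z E ih =>
    exact .mu hS z ih
      fun γ v h => by cases h with | mu _ g hg hfix hmin => exact ⟨g, hg, hfix, hmin⟩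

end OmegaPMA

/-- The body of a μ-binder denotes a Scott-continuous function of the bound variable. -/
theorem CInterp.scottContinuous_body {A L C K : Type} [PartialOrder C] [DecidableEq K] {n : ℕ}
    (Q : MarkovAlg L C) (ia : A → C) {E : PExp A L K n} {z : K} {γ : K → C} {ν : Fin n → C}
    {g : C → C} (hg : ∀ θ, CInterp Q ia E (Function.update γ z θ) ν (g θ)) :
    ScottContinuous g := fun d hd hdir s hs => by
  have := hd.to_subtype
  have := hdir.isDirectedOrder
  have := (monoCont Q ia ν E).preservesSup_update (Q.admissibleIndex d) hg Subtype.val s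
    (Subtype.mono_coe _) (by rwa [Subtype.range_coe])
  rwa [Set.image_eq_range]

/-- The body of a μ-binder denotes an ω-continuous function of the bound variable. -/
theorem PInterp.isOmegaCont_body {A L M K : Type} [DecidableEq K] {n : ℕ}
    (P : OmegaPMA L M) (ia : A → M) {E : PExp A L K n} {z : K} {γ : K → M} {ν : Fin n → M}
    {g : M → M} (hg : ∀ θ, PInterp P ia E (Function.update γ z θ) ν (g θ)) :
    IsOmegaCont P.le g := by
  let := P.partialOrder
  have h := monoCont P ia ν E
  refine ⟨fun a b hab => h.monotone_update hg hab, fun c s hc hs => ?_⟩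
  rw [P.isChainSup_iff_isLUB] at hs ⊢
  exact h.preservesSup_update P.omegaContOps.nat hg c s (monotone_nat_of_le_succ hc) hs

/-- A soundness relation relates the least fixed points of related unary functions. -/
theorem IsSoundRel.lfp {A L C M : Type} [PartialOrder C] {Q : MarkovAlg L C} {P : OmegaPMA L M}
    {iaC : A → C} {iaM : A → M} {R : C → M → Prop} (hR : IsSoundRel Q P iaC iaM R)
    {f : C → C} {g : M → M} (hf : ScottContinuous f) (hg : IsOmegaCont P.le g)
    (hfg : ∀ x y, R x y → R (f x) (g y)) {v : C} {w : M}
    (hv : f v = v) (hvmin : ∀ u, f u = u → v ≤ u)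
    (hw : g w = w) (hwmin : ∀ u, g u = u → P.le w u) : R v w := by
  refine hR.2.2.2.2 1 (fun x _ => f (x 0)) (fun y _ => g (y 0)) ?_
    (fun y y' hy _ => hg.1 _ _ (hy 0)) (fun c s hc hs _ => hg.2 _ _ (fun j => hc j 0) (hs 0))
    (fun x y hxy _ => hfg _ _ (hxy 0)) (fun _ => v) (fun _ => w)
    ⟨funext fun _ => hv, fun x hx _ => ?_⟩ ⟨funext fun _ => hw, fun y hy i => ?_⟩ 0
  · intro d hd hdir s hs
    refine isLUB_pi.2 fun i => ?_
    have := hf (hd.image fun x => x 0) (hdir.mono_comp fun _ _ h => h 0) (isLUB_pi.1 hs 0)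
    rw [Set.image_image] at this ⊢
    exact this
  · exact (hvmin (x 0) (congrFun hx 0)).trans_eq (congrArg x (Subsingleton.elim _ _))
  · rw [Subsingleton.elim i 0]
    exact hwmin (y 0) (congrFun hy 0)

theorem rel_update {C M K : Type} [DecidableEq K] {R : C → M → Prop} {γ : K → C} {γs : K → M}
    (hγ : ∀ z, R (γ z) (γs z)) (z : K) {x : C} {y : M} (hxy : R x y) (k : K) :
    R (Function.update γ z x k) (Function.update γs z y k) := by
  rcases eq_or_ne k z with rfl | h
  · simpa using hxy
  · simpa [h] using hγ k

/-- Soundness of ωPMA interpretation w.r.t. Markov-algebra (concrete) interpretation: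
if `⊩` is a soundness relation, `γ(Z) ⊩ γ♯(Z)` for all variables and `ν_i ⊩ ν♯_i` for
all procedures, then `C_γ⟦E⟧(ν) ⊩ M_{γ♯}⟦E⟧(ν♯)` for every regular infinite-tree
expression `E`. -/
theorem interp_soundness {A L C M K : Type} [PartialOrder C] [DecidableEq K] {n : ℕ}
    (Q : MarkovAlg L C) (P : OmegaPMA L M) (iaC : A → C) (iaM : A → M)
    (R : C → M → Prop) (hR : IsSoundRel Q P iaC iaM R)
    (E : PExp A L K n)
    (γ : K → C) (γs : K → M) (hγ : ∀ z, R (γ z) (γs z))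
    (ν : Fin n → C) (νs : Fin n → M) (hν : ∀ i, R (ν i) (νs i))
    (v : C) (vs : M)
    (hv : CInterp Q iaC E γ ν v) (hvs : PInterp P iaM E γs νs vs) :
    R v vs := by
  have hop := hR.2.2.2.1
  induction E generalizing γ γs v vs with
  | eps =>
    cases hv
    cases hvs
    exact hR.2.2.1
  | var z =>
    cases hv
    cases hvs
    exact hγ z
  | seq act E ih =>
    cases hv with | seq _ hv =>
    cases hvs with | seq _ hvs =>
    exact (hop _ _ _ _ (hR.1 act) (ih _ _ hγ _ _ hv hvs)).1
  | call i E ih =>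
    cases hv with | call _ hv =>
    cases hvs with | call _ hvs =>
    exact (hop _ _ _ _ (hν i) (ih _ _ hγ _ _ hv hvs)).1
  | cond φ E₁ E₂ ih₁ ih₂ =>
    cases hv with | cond _ hv₁ hv₂ =>
    cases hvs with | cond _ hvs₁ hvs₂ =>
    exact (hop _ _ _ _ (ih₁ _ _ hγ _ _ hv₁ hvs₁) (ih₂ _ _ hγ _ _ hv₂ hvs₂)).2.1 φ
  | prob p E₁ E₂ ih₁ ih₂ =>
    cases hv with | prob _ hv₁ hv₂ =>
    cases hvs with | prob _ hvs₁ hvs₂ =>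
    exact (hop _ _ _ _ (ih₁ _ _ hγ _ _ hv₁ hvs₁) (ih₂ _ _ hγ _ _ hv₂ hvs₂)).2.2.1 p
  | ndet E₁ E₂ ih₁ ih₂ =>
    cases hv with | ndet hv₁ hv₂ =>
    cases hvs with | ndet hvs₁ hvs₂ =>
    exact (hop _ _ _ _ (ih₁ _ _ hγ _ _ hv₁ hvs₁) (ih₂ _ _ hγ _ _ hv₂ hvs₂)).2.2.2
  | concat z E₁ E₂ ih₁ ih₂ =>
    cases hv with | concat _ hv₂ hv₁ =>
    cases hvs with | concat _ hvs₂ hvs₁ =>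
    exact ih₁ _ _ (rel_update hγ z (ih₂ _ _ hγ _ _ hv₂ hvs₂)) _ _ hv₁ hvs₁
  | mu z E ih =>
    cases hv with | mu _ f hf hfix hmin =>
    cases hvs with | mu _ g hg hfixs hmins =>
    exact hR.lfp (CInterp.scottContinuous_body Q iaC hf) (PInterp.isOmegaCont_body P iaM hg)
      (fun x y hxy => ih _ _ (rel_update hγ z hxy) _ _ (hf x) (hg y)) hfix hmin hfixs hmins
end

section
/- Let (C, ⟦·⟧^C) be a Markov-algebra interpretation, (M, ⟦·⟧^M) an ωPMA interpretation, and ⊩ ⊆ C × M a soundness relation. If P = {X_i = E_{X_i}}_{i=1}^n is an interprocedural equation system with E_{X_i} ∈ RegExp^∞(F, ∅) for each i, then the concrete program semantics is approximated componentwise by the abstract one: lfp_{0̄_C} λθ. ⟨C_{{}}⟦E_{X_1}⟧(θ), …, C_{{}}⟦E_{X_n}⟧(θ)⟩ ⊩ lfp_{0̄_M} λθ♯. ⟨M_{{}}⟦E_{X_1}⟧(θ♯), …, M_{{}}⟦E_{X_n}⟧(θ♯)⟩. -/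
section DirectedContinuity

variable {X Y Z W : Type*} [Preorder X] [Preorder Y] [Preorder Z] [Preorder W]
  {J : Type} [Preorder J]

/-- `f` is monotone and preserves the least upper bounds of monotone families indexed by `J`. -/
def DirCont (J : Type) [Preorder J] (f : X → Y) : Prop :=
  Monotone f ∧ ∀ (c : J → X) (s : X), Monotone c → IsLUB (Set.range c) s →
    IsLUB (Set.range fun j => f (c j)) (f s)

theorem DirCont.comp {g : Y → Z} {f : X → Y} (hg : DirCont J g) (hf : DirCont J f) :
    DirCont J fun x => g (f x) :=
  ⟨hg.1.comp hf.1, fun c s hc hs => hg.2 _ _ (hf.1.comp hc) (hf.2 c s hc hs)⟩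

theorem dirCont_const [Nonempty J] (y : Y) : DirCont J fun _ : X => y :=
  ⟨monotone_const, fun _ _ _ _ => by simp⟩

theorem dirCont_id : DirCont J fun x : X => x :=
  ⟨monotone_id, fun _ _ _ hs => hs⟩

theorem dirCont_apply {ι : Type*} (i : ι) : DirCont J fun x : ι → X => x i :=
  ⟨fun _ _ h => h i, fun c s _ hs => by
    have h := isLUB_pi.1 hs i
    rwa [← Set.range_comp] at h⟩

theorem DirCont.pi {ι : Type*} {f : X → ι → Y} (hf : ∀ i, DirCont J fun x => f x i) :
    DirCont J f :=
  ⟨fun _ _ h i => (hf i).1 h, fun c s hc hs => isLUB_pi.2 fun i => by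
    have h := (hf i).2 c s hc hs
    rwa [← Set.range_comp]⟩

theorem dirCont_fst : DirCont J fun x : X × Y => x.1 :=
  ⟨fun _ _ h => h.1, fun c s _ hs => by
    have h := (isLUB_prod.1 hs).1
    rwa [← Set.range_comp] at h⟩

theorem dirCont_snd : DirCont J fun x : X × Y => x.2 :=
  ⟨fun _ _ h => h.2, fun c s _ hs => by
    have h := (isLUB_prod.1 hs).2
    rwa [← Set.range_comp] at h⟩

theorem DirCont.prodMk {f : X → Y} {g : X → Z} (hf : DirCont J f) (hg : DirCont J g) :
    DirCont J fun x => (f x, g x) :=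
  ⟨fun _ _ h => ⟨hf.1 h, hg.1 h⟩, fun c s hc hs => isLUB_prod.2 ⟨by
    rw [← Set.range_comp]; exact hf.2 c s hc hs, by
    rw [← Set.range_comp]; exact hg.2 c s hc hs⟩⟩

theorem DirCont.update {K : Type*} [DecidableEq K] {f : X → K → Y} {g : X → Y} (z : K)
    (hf : DirCont J f) (hg : DirCont J g) :
    DirCont J fun x => Function.update (f x) z (g x) := by
  refine DirCont.pi fun k => ?_
  by_cases hk : k = z
  · subst hk
    simpa using hg
  · simpa [hk] using (dirCont_apply k).comp hf

/-- A separately continuous binary operation is jointly continuous. -/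
theorem DirCont.map₂ [IsDirectedOrder J] {op : Y → Z → W} {f : X → Y} {g : X → Z}
    (hl : ∀ b, DirCont J fun a => op a b) (hr : ∀ a, DirCont J (op a))
    (hf : DirCont J f) (hg : DirCont J g) : DirCont J fun x => op (f x) (g x) := by
  have hmono : ∀ {a a' b b'}, a ≤ a' → b ≤ b' → op a b ≤ op a' b' := fun ha hb =>
    ((hl _).1 ha).trans ((hr _).1 hb)
  refine ⟨fun _ _ h => hmono (hf.1 h) (hg.1 h), fun c s hc hs => ⟨?_, fun u hu => ?_⟩⟩
  · rintro _ ⟨j, rfl⟩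
    have := hs.1 ⟨j, rfl⟩
    exact hmono (hf.1 this) (hg.1 this)
  · refine ((hr (f s)).2 _ _ (hg.1.comp hc) (hg.2 c s hc hs)).2 ?_
    rintro _ ⟨j, rfl⟩
    refine ((hl (g (c j))).2 _ _ (hf.1.comp hc) (hf.2 c s hc hs)).2 ?_
    rintro _ ⟨i, rfl⟩
    obtain ⟨k, hik, hjk⟩ := exists_ge_ge i j
    exact (hmono (hf.1 (hc hik)) (hg.1 (hc hjk))).trans (hu ⟨k, rfl⟩)

/-- A pointwise supremum of continuous functions is continuous. -/
theorem DirCont.of_isLUB {ι : Type*} {f : ι → X → Y} {g : X → Y} (hf : ∀ i, DirCont J (f i))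
    (hg : ∀ x, IsLUB (Set.range fun i => f i x) (g x)) : DirCont J g := by
  have hmono : Monotone g := fun x y h => (hg x).2 <| by
    rintro _ ⟨i, rfl⟩
    exact ((hf i).1 h).trans ((hg y).1 ⟨i, rfl⟩)
  refine ⟨hmono, fun c s hc hs => ⟨?_, fun u hu => (hg s).2 ?_⟩⟩
  · rintro _ ⟨j, rfl⟩
    exact hmono (hs.1 ⟨j, rfl⟩)
  · rintro _ ⟨i, rfl⟩
    refine ((hf i).2 c s hc hs).2 ?_
    rintro _ ⟨j, rfl⟩
    exact ((hg (c j)).1 ⟨i, rfl⟩).trans (hu ⟨j, rfl⟩)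

theorem ScottContinuous.dirCont [IsDirectedOrder J] [Nonempty J] {f : X → Y}
    (hf : ScottContinuous f) : DirCont J f := by
  refine ⟨hf.monotone, fun c s hc hs => ?_⟩
  have h := hf (Set.range_nonempty c) (hc.directed_le.directedOn_range) hs
  rwa [← Set.range_comp] at h

theorem scottContinuous_of_dirCont {X Y : Type} [Preorder X] [Preorder Y] {f : X → Y}
    (hf : ∀ (J : Type) [Preorder J] [IsDirectedOrder J] [Nonempty J], DirCont J f) :
    ScottContinuous f := by
  intro d hne hd s hs
  have : Nonempty d := hne.to_subtype
  have : IsDirectedOrder d := ⟨directedOn_iff_directed.1 hd⟩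
  have h := (hf d).2 Subtype.val s (fun _ _ h => h) (by simpa using hs)
  rwa [Set.image_eq_range]

/-- Kleene's fixed point theorem. -/
theorem DirCont.exists_isLeast_fixedPoint {X : Type*} [PartialOrder X] {f : X → X}
    (hf : DirCont ℕ f) {b : X} (hb : ∀ x, b ≤ x)
    (hsup : ∀ c : ℕ → X, Monotone c → ∃ s, IsLUB (Set.range c) s) :
    ∃ v, IsLUB (Set.range fun m => f^[m] b) v ∧ IsLeast {w | f w = w} v := by
  have hc : Monotone fun m => f^[m] b := hf.1.monotone_iterate_of_le_map (hb _)
  obtain ⟨v, hv⟩ := hsup _ hc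
  refine ⟨v, hv, ?_, fun w hw => hv.2 ?_⟩
  · refine (hf.2 _ _ hc hv).unique ⟨?_, fun u hu => hv.2 ?_⟩
    · rintro _ ⟨m, rfl⟩
      exact hv.1 ⟨m + 1, Function.iterate_succ_apply' f m b⟩
    · rintro _ ⟨m, rfl⟩
      refine (hc m.le_succ).trans (hu ⟨m, ?_⟩)
      exact (Function.iterate_succ_apply' f m b).symm
  · rintro _ ⟨m, rfl⟩
    have h := hf.1.iterate m (hb w)
    rwa [Function.iterate_fixed hw] at h

end DirectedContinuity

/-- The operations needed to interpret program expressions. -/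
structure ProgOps (A L X : Type) where
  bot : X
  one : X
  act : A → X
  mul : X → X → X
  cond : L → X → X → X
  prob : Prob → X → X → X
  ndet : X → X → X

namespace ProgOps

/-- All operations are separately continuous for suprema of `J`-indexed families. -/
structure Cont {A L X : Type} [PartialOrder X] (B : ProgOps A L X) (J : Type) [Preorder J] :
    Prop where
  mul_left : ∀ b, DirCont J fun a => B.mul a b
  mul_right : ∀ a, DirCont J (B.mul a)
  cond_left : ∀ φ b, DirCont J fun a => B.cond φ a b
  cond_right : ∀ φ a, DirCont J (B.cond φ a)
  prob_left : ∀ p b, DirCont J fun a => B.prob p a b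
  prob_right : ∀ p a, DirCont J (B.prob p a)
  ndet_left : ∀ b, DirCont J fun a => B.ndet a b
  ndet_right : ∀ a, DirCont J (B.ndet a)

/-- The operations live on an ω-complete pointed order and are ω-continuous. -/
structure OmegaCont {A L X : Type} [PartialOrder X] (B : ProgOps A L X) : Prop where
  cont : B.Cont ℕ
  bot_le : ∀ x, B.bot ≤ x
  exists_sup : ∀ c : ℕ → X, Monotone c → ∃ s, IsLUB (Set.range c) s

variable {A L X K : Type} {n : ℕ} [DecidableEq K] [PartialOrder X]

open Classical in
/-- The least fixed point of `f`, with junk value `1` if there is none. -/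
noncomputable def lfp (B : ProgOps A L X) (f : X → X) : X :=
  if h : ∃ v, IsLeast {w | f w = w} v then h.choose else B.one

theorem lfp_eq (B : ProgOps A L X) {f : X → X} {v : X} (hv : IsLeast {w | f w = w} v) :
    B.lfp f = v := by
  have h : ∃ v, IsLeast {w | f w = w} v := ⟨v, hv⟩
  rw [lfp, dif_pos h]
  exact h.choose_spec.unique hv

/-- The interpretation of program expressions as a function. -/
noncomputable def eval (B : ProgOps A L X) :
    PExp A L K n → (K → X) → (Fin n → X) → X
  | .eps, _, _ => B.one
  | .var z, γ, _ => γ z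
  | .seq a E, γ, ν => B.mul (B.act a) (B.eval E γ ν)
  | .call i E, γ, ν => B.mul (ν i) (B.eval E γ ν)
  | .cond φ E₁ E₂, γ, ν => B.cond φ (B.eval E₁ γ ν) (B.eval E₂ γ ν)
  | .prob p E₁ E₂, γ, ν => B.prob p (B.eval E₁ γ ν) (B.eval E₂ γ ν)
  | .ndet E₁ E₂, γ, ν => B.ndet (B.eval E₁ γ ν) (B.eval E₂ γ ν)
  | .concat z E₁ E₂, γ, ν => B.eval E₁ (Function.update γ z (B.eval E₂ γ ν)) ν
  | .mu z E, γ, ν => B.lfp fun θ => B.eval E (Function.update γ z θ) ν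

variable {B : ProgOps A L X}

theorem OmegaCont.lfp_spec (hB : B.OmegaCont) {f : X → X} (hf : DirCont ℕ f) :
    IsLUB (Set.range fun m => f^[m] B.bot) (B.lfp f) ∧ IsLeast {w | f w = w} (B.lfp f) := by
  obtain ⟨v, hv, hleast⟩ := hf.exists_isLeast_fixedPoint hB.bot_le hB.exists_sup
  rw [B.lfp_eq hleast]
  exact ⟨hv, hleast⟩

/-- Parametrised least fixed points depend continuously on the parameter. -/
theorem OmegaCont.dirCont_lfp (hB : B.OmegaCont) {Y : Type*} [Preorder Y]
    {J : Type} [Preorder J] [Nonempty J] {F : Y → X → X}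
    (hF : ∀ y, DirCont ℕ (F y)) (hJ : DirCont J fun e : Y × X => F e.1 e.2) :
    DirCont J fun y => B.lfp (F y) := by
  refine DirCont.of_isLUB (f := fun m y => (F y)^[m] B.bot) (fun m => ?_)
    fun y => (hB.lfp_spec (hF y)).1
  induction m with
  | zero => exact dirCont_const _
  | succ m ih =>
    simp only [Function.iterate_succ_apply']
    exact hJ.comp (dirCont_id.prodMk ih)

theorem OmegaCont.dirCont_eval (hB : B.OmegaCont) {J : Type} [Preorder J] [IsDirectedOrder J]
    [Nonempty J] (hJ : B.Cont J) (E : PExp A L K n) :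
    DirCont ℕ (fun e : (K → X) × (Fin n → X) => B.eval E e.1 e.2) ∧
      DirCont J (fun e : (K → X) × (Fin n → X) => B.eval E e.1 e.2) := by
  have hN := hB.cont
  induction E with
  | eps => exact ⟨dirCont_const _, dirCont_const _⟩
  | var z => exact ⟨(dirCont_apply z).comp dirCont_fst, (dirCont_apply z).comp dirCont_fst⟩
  | seq a E ih => exact ⟨(hN.mul_right _).comp ih.1, (hJ.mul_right _).comp ih.2⟩
  | call i E ih =>
    simp only [eval]
    exact ⟨.map₂ hN.mul_left hN.mul_right ((dirCont_apply i).comp dirCont_snd) ih.1,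
      .map₂ hJ.mul_left hJ.mul_right ((dirCont_apply i).comp dirCont_snd) ih.2⟩
  | cond φ E₁ E₂ ih₁ ih₂ =>
    simp only [eval]
    exact ⟨.map₂ (hN.cond_left φ) (hN.cond_right φ) ih₁.1 ih₂.1,
      .map₂ (hJ.cond_left φ) (hJ.cond_right φ) ih₁.2 ih₂.2⟩
  | prob p E₁ E₂ ih₁ ih₂ =>
    simp only [eval]
    exact ⟨.map₂ (hN.prob_left p) (hN.prob_right p) ih₁.1 ih₂.1,
      .map₂ (hJ.prob_left p) (hJ.prob_right p) ih₁.2 ih₂.2⟩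
  | ndet E₁ E₂ ih₁ ih₂ =>
    simp only [eval]
    exact ⟨.map₂ hN.ndet_left hN.ndet_right ih₁.1 ih₂.1,
      .map₂ hJ.ndet_left hJ.ndet_right ih₁.2 ih₂.2⟩
  | concat z E₁ E₂ ih₁ ih₂ =>
    exact ⟨ih₁.1.comp ((dirCont_fst.update z ih₂.1).prodMk dirCont_snd),
      ih₁.2.comp ((dirCont_fst.update z ih₂.2).prodMk dirCont_snd)⟩
  | mu z E ih =>
    have hF : ∀ e : (K → X) × (Fin n → X),
        DirCont ℕ fun θ => B.eval E (Function.update e.1 z θ) e.2 := fun e =>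
      ih.1.comp (((dirCont_const e.1).update z dirCont_id).prodMk (dirCont_const e.2))
    exact ⟨hB.dirCont_lfp hF (ih.1.comp (((dirCont_fst.comp dirCont_fst).update z
        dirCont_snd).prodMk (dirCont_snd.comp dirCont_fst))),
      hB.dirCont_lfp hF (ih.2.comp (((dirCont_fst.comp dirCont_fst).update z
        dirCont_snd).prodMk (dirCont_snd.comp dirCont_fst)))⟩

theorem OmegaCont.dirCont_eval_update (hB : B.OmegaCont) {J : Type} [Preorder J]
    [IsDirectedOrder J] [Nonempty J] (hJ : B.Cont J) (E : PExp A L K n) (z : K)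
    (γ : K → X) (ν : Fin n → X) :
    DirCont J fun θ => B.eval E (Function.update γ z θ) ν :=
  (hB.dirCont_eval hJ E).2.comp
    (((dirCont_const γ).update z dirCont_id).prodMk (dirCont_const ν))

theorem OmegaCont.eval_mu_isLeast (hB : B.OmegaCont) (E : PExp A L K n) (z : K)
    (γ : K → X) (ν : Fin n → X) :
    IsLeast {w | B.eval E (Function.update γ z w) ν = w} (B.eval (.mu z E) γ ν) :=
  (hB.lfp_spec (hB.dirCont_eval_update hB.cont E z γ ν)).2

end ProgOps

namespace MarkovAlg

variable {A L C K : Type} [PartialOrder C] {n : ℕ} [DecidableEq K]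

/-- The operations of a Markov-algebra interpretation. -/
def progOps (Q : MarkovAlg L C) (ia : A → C) : ProgOps A L C :=
  ⟨Q.bot, Q.one, ia, Q.mul, Q.cond, Q.prob, Q.ndet⟩

theorem progOps_cont (Q : MarkovAlg L C) (ia : A → C) (J : Type) [Preorder J]
    [IsDirectedOrder J] [Nonempty J] : (Q.progOps ia).Cont J where
  mul_left b := (Q.mul_scott_left b).dirCont
  mul_right a := (Q.mul_scott_right a).dirCont
  cond_left φ b := (Q.cond_scott_left φ b).dirCont
  cond_right φ a := (Q.cond_scott_right φ a).dirCont
  prob_left p b := (Q.prob_scott_left p b).dirCont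
  prob_right p a := (Q.prob_scott_right p a).dirCont
  ndet_left b := (Q.ndet_scott_left b).dirCont
  ndet_right a := (Q.ndet_scott_right a).dirCont

theorem progOps_omegaCont (Q : MarkovAlg L C) (ia : A → C) : (Q.progOps ia).OmegaCont where
  cont := Q.progOps_cont ia ℕ
  bot_le := Q.bot_le
  exists_sup c hc := Q.dcpo _ (Set.range_nonempty c) hc.directed_le.directedOn_range

theorem cInterp_iff (Q : MarkovAlg L C) (ia : A → C) {E : PExp A L K n} {γ : K → C}
    {ν : Fin n → C} {v : C} : CInterp Q ia E γ ν v ↔ (Q.progOps ia).eval E γ ν = v := by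
  constructor
  · intro h
    induction h with
    | eps | var => rfl
    | seq _ _ ih => subst ih; rfl
    | call _ _ ih => subst ih; rfl
    | cond _ _ _ ih₁ ih₂ => subst ih₁ ih₂; rfl
    | prob _ _ _ ih₁ ih₂ => subst ih₁ ih₂; rfl
    | ndet _ _ ih₁ ih₂ => subst ih₁ ih₂; rfl
    | concat _ _ _ ih₁ ih₂ => subst ih₁ ih₂; rfl
    | mu z g _ hfix hleast ih =>
      obtain rfl : _ = g := funext ih
      exact ProgOps.lfp_eq _ ⟨hfix, fun w hw => hleast w hw⟩
  · rintro rfl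
    induction E generalizing γ with
    | eps => exact .eps _ _
    | var z => exact .var _ _ _
    | seq a E ih => exact .seq a ih
    | call i E ih => exact .call i ih
    | cond φ E₁ E₂ ih₁ ih₂ => exact .cond φ ih₁ ih₂
    | prob p E₁ E₂ ih₁ ih₂ => exact .prob p ih₁ ih₂
    | ndet E₁ E₂ ih₁ ih₂ => exact .ndet ih₁ ih₂
    | concat z E₁ E₂ ih₁ ih₂ => exact .concat z ih₂ ih₁
    | mu z E ih =>
      have h := (Q.progOps_omegaCont ia).eval_mu_isLeast E z γ ν
      exact .mu z _ (fun θ => ih) h.1 fun w hw => h.2 hw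

end MarkovAlg

namespace OmegaPMA

variable {A L M K : Type} {n : ℕ} [DecidableEq K]

/-- The partial order induced by `⊕`. -/
@[reducible] def partialOrder_s18 (P : OmegaPMA L M) : PartialOrder M where
  le := P.le
  le_refl a := ⟨P.zero, P.add_zero a⟩
  le_trans := by
    rintro a _ _ ⟨d, rfl⟩ ⟨e, rfl⟩
    exact ⟨P.add d e, (P.add_assoc a d e).symm⟩
  le_antisymm := P.le_antisymm

/-- The operations of an ωPMA interpretation. -/
def progOps (P : OmegaPMA L M) (ia : A → M) : ProgOps A L M :=
  ⟨P.zero, P.one, ia, P.mul, P.cond, P.prob, P.ndet⟩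

theorem isChainSup_iff (P : OmegaPMA L M) {c : ℕ → M} {s : M} :
    IsChainSup P.le c s ↔ letI := P.partialOrder_s18; IsLUB (Set.range c) s := by
  let := P.partialOrder_s18
  constructor
  · rintro ⟨h₁, h₂⟩
    exact ⟨by rintro _ ⟨j, rfl⟩; exact h₁ j, fun u hu => h₂ u fun j => hu ⟨j, rfl⟩⟩
  · rintro ⟨h₁, h₂⟩
    exact ⟨fun j => h₁ ⟨j, rfl⟩, fun u hu => h₂ (by rintro _ ⟨j, rfl⟩; exact hu j)⟩

theorem dirCont_of_isOmegaCont (P : OmegaPMA L M) {f : M → M} (hf : IsOmegaCont P.le f) :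
    letI := P.partialOrder_s18; DirCont ℕ f := by
  let := P.partialOrder_s18
  exact ⟨fun a b h => hf.1 a b h, fun c s hc hs => P.isChainSup_iff.1
    (hf.2 c s (fun i => hc i.le_succ) (P.isChainSup_iff.2 hs))⟩

theorem progOps_omegaCont (P : OmegaPMA L M) (ia : A → M) :
    letI := P.partialOrder_s18; (P.progOps ia).OmegaCont := by
  let := P.partialOrder_s18
  exact {
    cont := {
      mul_left := fun b => P.dirCont_of_isOmegaCont (P.mul_cont_left b)
      mul_right := fun a => P.dirCont_of_isOmegaCont (P.mul_cont_right a)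
      cond_left := fun φ b => P.dirCont_of_isOmegaCont (P.cond_cont_left φ b)
      cond_right := fun φ a => P.dirCont_of_isOmegaCont (P.cond_cont_right φ a)
      prob_left := fun p b => P.dirCont_of_isOmegaCont (P.prob_cont_left p b)
      prob_right := fun p a => P.dirCont_of_isOmegaCont (P.prob_cont_right p a)
      ndet_left := fun b => P.dirCont_of_isOmegaCont (P.ndet_cont_left b)
      ndet_right := fun a => P.dirCont_of_isOmegaCont (P.ndet_cont_right a) }
    bot_le := fun x => ⟨x, by rw [P.add_comm]; exact P.add_zero x⟩
    exists_sup := fun c hc =>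
      (P.chain_sup c fun i => hc i.le_succ).imp fun _ hs => P.isChainSup_iff.1 hs }

theorem pInterp_iff (P : OmegaPMA L M) (ia : A → M) {E : PExp A L K n} {γ : K → M}
    {ν : Fin n → M} {v : M} :
    PInterp P ia E γ ν v ↔ letI := P.partialOrder_s18; (P.progOps ia).eval E γ ν = v := by
  let := P.partialOrder_s18
  constructor
  · intro h
    induction h with
    | eps | var => rfl
    | seq _ _ ih => subst ih; rfl
    | call _ _ ih => subst ih; rfl
    | cond _ _ _ ih₁ ih₂ => subst ih₁ ih₂; rfl
    | prob _ _ _ ih₁ ih₂ => subst ih₁ ih₂; rfl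
    | ndet _ _ ih₁ ih₂ => subst ih₁ ih₂; rfl
    | concat _ _ _ ih₁ ih₂ => subst ih₁ ih₂; rfl
    | mu z g _ hfix hleast ih =>
      obtain rfl : _ = g := funext ih
      exact ProgOps.lfp_eq _ ⟨hfix, fun w hw => hleast w hw⟩
  · rintro rfl
    induction E generalizing γ with
    | eps => exact .eps _ _
    | var z => exact .var _ _ _
    | seq a E ih => exact .seq a ih
    | call i E ih => exact .call i ih
    | cond φ E₁ E₂ ih₁ ih₂ => exact .cond φ ih₁ ih₂
    | prob p E₁ E₂ ih₁ ih₂ => exact .prob p ih₁ ih₂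
    | ndet E₁ E₂ ih₁ ih₂ => exact .ndet ih₁ ih₂
    | concat z E₁ E₂ ih₁ ih₂ => exact .concat z ih₂ ih₁
    | mu z E ih =>
      have h := (P.progOps_omegaCont ia).eval_mu_isLeast E z γ ν
      exact .mu z _ (fun θ => ih) h.1 fun w hw => h.2 hw

end OmegaPMA

namespace IsSoundRel

variable {A L C M K : Type} [PartialOrder C] {n : ℕ} [DecidableEq K]
  {Q : MarkovAlg L C} {P : OmegaPMA L M} {iaC : A → C} {iaM : A → M} {R : C → M → Prop}

/-- Least fixed points of related continuous vector functions are related. -/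
theorem rel_lfp (hR : IsSoundRel Q P iaC iaM R) {k : ℕ}
    {f : (Fin k → C) → Fin k → C} {g : (Fin k → M) → Fin k → M}
    (hf : ∀ (J : Type) [Preorder J] [IsDirectedOrder J] [Nonempty J], DirCont J f)
    (hg : letI := P.partialOrder_s18; DirCont ℕ g)
    (hfg : ∀ x y, (∀ i, R (x i) (y i)) → ∀ i, R (f x i) (g y i))
    {x : Fin k → C} {y : Fin k → M} (hx : IsLeast {w | f w = w} x)
    (hy : letI := P.partialOrder_s18; IsLeast {w | g w = w} y) (i : Fin k) : R (x i) (y i) := by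
  let := P.partialOrder_s18
  refine hR.2.2.2.2 k f g (scottContinuous_of_dirCont hf) (fun a b h => hg.1 h) ?_ hfg x y
    ⟨hx.1, fun w hw => hx.2 hw⟩ ⟨hy.1, fun w hw => hy.2 hw⟩ i
  intro c s hc hs i
  have hs' : IsLUB (Set.range c) s := isLUB_pi.2 fun i => by
    rw [← Set.range_comp]
    exact P.isChainSup_iff.1 (hs i)
  exact P.isChainSup_iff.2 (((dirCont_apply i).comp hg).2 c s
    (monotone_nat_of_le_succ fun j i => hc j i) hs')

theorem rel_eval (hR : IsSoundRel Q P iaC iaM R) {νC : Fin n → C} {νM : Fin n → M}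
    (hν : ∀ i, R (νC i) (νM i)) (E : PExp A L K n) {γC : K → C} {γM : K → M}
    (hγ : ∀ z ∈ E.fv, R (γC z) (γM z)) :
    letI := P.partialOrder_s18
    R ((Q.progOps iaC).eval E γC νC) ((P.progOps iaM).eval E γM νM) := by
  let := P.partialOrder_s18
  have hop := hR.2.2.2.1
  have hupdate : ∀ {s : Set K} {z : K} {γC : K → C} {γM : K → M} {a : C} {b : M},
      (∀ k ∈ s \ {z}, R (γC k) (γM k)) → R a b →
      ∀ k ∈ s, R (Function.update γC z a k) (Function.update γM z b k) := by
    intro s z γC γM a b h hab k hk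
    by_cases hkz : k = z
    · subst hkz
      simpa using hab
    · simpa [hkz] using h k ⟨hk, hkz⟩
  induction E generalizing γC γM with
  | eps => exact hR.2.2.1
  | var z => exact hγ z rfl
  | seq a E ih => exact (hop _ _ _ _ (hR.1 a) (ih hγ)).1
  | call i E ih => exact (hop _ _ _ _ (hν i) (ih hγ)).1
  | cond φ E₁ E₂ ih₁ ih₂ =>
    exact (hop _ _ _ _ (ih₁ fun z hz => hγ z (.inl hz)) (ih₂ fun z hz => hγ z (.inr hz))).2.1 φ
  | prob p E₁ E₂ ih₁ ih₂ =>
    exact (hop _ _ _ _ (ih₁ fun z hz => hγ z (.inl hz))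
      (ih₂ fun z hz => hγ z (.inr hz))).2.2.1 p
  | ndet E₁ E₂ ih₁ ih₂ =>
    exact (hop _ _ _ _ (ih₁ fun z hz => hγ z (.inl hz)) (ih₂ fun z hz => hγ z (.inr hz))).2.2.2
  | concat z E₁ E₂ ih₁ ih₂ =>
    exact ih₁ (hupdate (fun k hk => hγ k (.inl hk)) (ih₂ fun k hk => hγ k (.inr hk)))
  | mu z E ih =>
    have hC := Q.progOps_omegaCont iaC
    have hM := P.progOps_omegaCont iaM
    have hlC := hC.eval_mu_isLeast E z γC νC
    have hlM := hM.eval_mu_isLeast E z γM νM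
    refine hR.rel_lfp (k := 1)
      (f := fun x _ => (Q.progOps iaC).eval E (Function.update γC z (x 0)) νC)
      (g := fun y _ => (P.progOps iaM).eval E (Function.update γM z (y 0)) νM)
      (x := fun _ => (Q.progOps iaC).eval (.mu z E) γC νC)
      (y := fun _ => (P.progOps iaM).eval (.mu z E) γM νM)
      (fun J _ _ _ => .pi fun _ => (hC.dirCont_eval_update (Q.progOps_cont iaC J)
        E z γC νC).comp (dirCont_apply 0))
      (.pi fun _ => (hM.dirCont_eval_update hM.cont E z γM νM).comp (dirCont_apply 0))
      (fun x y hxy _ => ih (hupdate hγ (hxy 0)))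
      ⟨funext fun _ => hlC.1, fun w hw i => ?_⟩ ⟨funext fun _ => hlM.1, fun w hw i => ?_⟩ 0
    · rw [Subsingleton.elim i 0]
      exact hlC.2 (congrFun hw 0)
    · rw [Subsingleton.elim i 0]
      exact hlM.2 (congrFun hw 0)

end IsSoundRel


/-- Soundness for interprocedural equation systems: for a program
`P = {X_i = E_{X_i}}` with closed right-hand sides, the concrete semantics (the least
fixed point of the concrete interpretations) is approximated componentwise, via the
soundness relation, by the abstract semantics (the least fixed point of the ωPMA
interpretations). -/
theorem program_soundness {A L C M K : Type} [PartialOrder C] [DecidableEq K] {n : ℕ}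
    (Q : MarkovAlg L C) (P : OmegaPMA L M) (iaC : A → C) (iaM : A → M)
    (R : C → M → Prop) (hR : IsSoundRel Q P iaC iaM R)
    (E : Fin n → PExp A L K n) (hclosed : ∀ i, (E i).fv = ∅)
    (γC : K → C) (γM : K → M)
    (μC : Fin n → C) (μM : Fin n → M)
    (hμC_fix : ∀ i, CInterp Q iaC (E i) γC μC (μC i))
    (hμC_least : ∀ θ : Fin n → C, (∀ i, CInterp Q iaC (E i) γC θ (θ i)) → μC ≤ θ)
    (hμM_fix : ∀ i, PInterp P iaM (E i) γM μM (μM i))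
    (hμM_least : ∀ θ : Fin n → M, (∀ i, PInterp P iaM (E i) γM θ (θ i)) →
      ∀ i, P.le (μM i) (θ i)) :
    ∀ i, R (μC i) (μM i) := by
  let := P.partialOrder_s18
  have hC := Q.progOps_omegaCont iaC
  have hM := P.progOps_omegaCont iaM
  simp only [Q.cInterp_iff] at hμC_fix hμC_least
  simp only [P.pInterp_iff] at hμM_fix hμM_least
  exact hR.rel_lfp
    (f := fun θ i => (Q.progOps iaC).eval (E i) γC θ)
    (g := fun θ i => (P.progOps iaM).eval (E i) γM θ)
    (fun J _ _ _ => .pi fun i => (hC.dirCont_eval (Q.progOps_cont iaC J) (E i)).2.comp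
      ((dirCont_const γC).prodMk dirCont_id))
    (.pi fun i => (hM.dirCont_eval hM.cont (E i)).2.comp
      ((dirCont_const γM).prodMk dirCont_id))
    (fun x y hxy i => hR.rel_eval hxy (E i) (by simp [hclosed i]))
    ⟨funext hμC_fix, fun θ hθ => hμC_least θ fun i => congrFun hθ i⟩
    ⟨funext hμM_fix, fun θ hθ => hμM_least θ fun i => congrFun hθ i⟩
end
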